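/- Let N ∈ {2,3}, −1 + N/4 < s < 0, let 8/(4−N) < m ≤ 16/(4−N), set δ = (4−N)/8 − 1/m and ϱ = min{1/m, s/2 + (4−N)/8}, and let 0 < T ≤ 1. There is a constant C = C(s,N,m) such that for every family (β_k)_{k∈ℤ^N} of nonnegative reals with ∑_{k∈ℤ^N} β_k (1+4π²|k|²)^s < ∞, one has ‖ t^{2δ} ∑_{k∈ℤ^N} β_k e^{−8π²|k|² t} ‖_{L^{m/2}(0,T)} ≤ C T^{2ϱ} ∑_{k∈ℤ^N} β_k (1+4π²|k|²)^s. -/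

import Mathlib

open MeasureTheory Real

/-- The heat kernel is dominated by negative powers of frequency and time. -/
theorem exp_neg_two_mul_le_rpow_mul_rpow {s x t : ℝ} (hs₁ : -1 < s) (hs₂ : s < 0)
    (hx : 0 ≤ x) (ht₀ : 0 < t) (ht₁ : t ≤ 1) :
    Real.exp (-(2 * x * t)) ≤ t ^ s * (1 + x) ^ s := by
  have hxt : 0 ≤ x * t := by positivity
  have hy : 0 < t * (1 + x) := by positivity
  have key : (t * (1 + x)) ^ (-s) ≤ Real.exp (2 * x * t) :=
    calc (t * (1 + x)) ^ (-s) ≤ (1 + x * t) ^ (-s) :=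
          Real.rpow_le_rpow hy.le (by nlinarith) (by linarith)
      _ ≤ (1 + x * t) ^ (1 : ℝ) :=
          Real.rpow_le_rpow_of_exponent_le (by linarith) (by linarith)
      _ = x * t + 1 := by rw [Real.rpow_one, add_comm]
      _ ≤ Real.exp (x * t) := Real.add_one_le_exp _
      _ ≤ Real.exp (2 * x * t) := Real.exp_le_exp.mpr (by linarith)
  rw [← Real.mul_rpow ht₀.le (by positivity), Real.exp_neg]
  have h := inv_anti₀ (Real.rpow_pos_of_pos hy (-s)) key
  rwa [← Real.rpow_neg hy.le, neg_neg] at h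

/-- A function bounded by a multiple of a power on `(0, T]` has `L^p` norm bounded accordingly. -/
theorem integral_Ioc_rpow_le_of_le_mul_rpow {f : ℝ → ℝ} {p a S T : ℝ} (hp : 0 < p)
    (ha : 0 < p * a + 1) (hS : 0 ≤ S) (hT : 0 < T)
    (hf₀ : ∀ t ∈ Set.Ioc 0 T, 0 ≤ f t) (hf : ∀ t ∈ Set.Ioc 0 T, f t ≤ t ^ a * S) :
    (∫ t in Set.Ioc 0 T, f t ^ p) ^ p⁻¹ ≤ (p * a + 1)⁻¹ ^ p⁻¹ * T ^ (a + p⁻¹) * S := by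
  have hint : IntegrableOn (fun t : ℝ => t ^ (p * a) * S ^ p) (Set.Ioc 0 T) := by
    have h : IntervalIntegrable (fun t : ℝ => t ^ (p * a)) volume 0 T :=
      intervalIntegral.intervalIntegrable_rpow' (by linarith)
    exact ((intervalIntegrable_iff_integrableOn_Ioc_of_le hT.le).mp h).mul_const _
  have hle : (∫ t in Set.Ioc 0 T, f t ^ p) ≤ ∫ t in Set.Ioc 0 T, t ^ (p * a) * S ^ p := by
    refine integral_mono_of_nonneg ?_ hint ?_
    · filter_upwards [ae_restrict_mem measurableSet_Ioc] with t ht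
      exact Real.rpow_nonneg (hf₀ t ht) _
    · filter_upwards [ae_restrict_mem measurableSet_Ioc] with t ht
      have h := Real.rpow_le_rpow (hf₀ t ht) (hf t ht) hp.le
      rwa [Real.mul_rpow (Real.rpow_nonneg ht.1.le _) hS, ← Real.rpow_mul ht.1.le,
        mul_comm a p] at h
  have hval : (∫ t in Set.Ioc 0 T, t ^ (p * a) * S ^ p)
      = (p * a + 1)⁻¹ * T ^ (p * a + 1) * S ^ p := by
    rw [integral_mul_const, ← intervalIntegral.integral_of_le hT.le,
      integral_rpow (Or.inl (by linarith)), Real.zero_rpow ha.ne']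
    ring
  have h₀ : 0 ≤ ∫ t in Set.Ioc 0 T, f t ^ p :=
    setIntegral_nonneg measurableSet_Ioc fun t ht => Real.rpow_nonneg (hf₀ t ht) _
  refine (Real.rpow_le_rpow h₀ (hle.trans_eq hval) (by positivity)).trans_eq ?_
  rw [Real.mul_rpow (by positivity) (by positivity), Real.mul_rpow (by positivity) (by positivity),
    Real.rpow_rpow_inv hS hp.ne', ← Real.rpow_mul hT.le,
    show (p * a + 1) * p⁻¹ = a + p⁻¹ by field_simp]

/-- for `N ∈ {2,3}`, `−1 + N/4 < s < 0`, `8/(4−N) < m ≤ 16/(4−N)`,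
`δ = (4−N)/8 − 1/m` and `ϱ = min{1/m, s/2 + (4−N)/8}`, there is `C = C(s,N,m)` such that
for all `0 < T ≤ 1` and all nonnegative `(β_k)_{k ∈ ℤ^N}` with
`∑_k β_k (1+4π²|k|²)^s < ∞` one has
`‖ t^{2δ} ∑_k β_k e^{−8π²|k|² t} ‖_{L^{m/2}(0,T)} ≤ C T^{2ϱ} ∑_k β_k (1+4π²|k|²)^s`. -/
theorem stmt9 (N : ℕ) (hN : N = 2 ∨ N = 3) (s m δ ϱ : ℝ) (hs₁ : -1 + (N : ℝ) / 4 < s)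
    (hs₂ : s < 0) (hm₁ : 8 / (4 - (N : ℝ)) < m) (hm₂ : m ≤ 16 / (4 - (N : ℝ)))
    (hδ : δ = (4 - (N : ℝ)) / 8 - 1 / m)
    (hϱ : ϱ = min (1 / m) (s / 2 + (4 - (N : ℝ)) / 8)) :
    ∃ C : ℝ, 0 < C ∧
      ∀ T : ℝ, 0 < T → T ≤ 1 →
        ∀ β : (Fin N → ℤ) → ℝ, (∀ k, 0 ≤ β k) →
          Summable (fun k : Fin N → ℤ =>
            β k * (1 + 4 * π ^ 2 * ∑ i, (k i : ℝ) ^ 2) ^ s) →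
          (∫ t in Set.Ioc (0 : ℝ) T,
              (t ^ (2 * δ) *
                ∑' k : Fin N → ℤ,
                  β k * Real.exp (-8 * π ^ 2 * (∑ i, (k i : ℝ) ^ 2) * t)) ^ (m / 2))
            ^ (2 / m) ≤
          C * T ^ (2 * ϱ) *
            ∑' k : Fin N → ℤ, β k * (1 + 4 * π ^ 2 * ∑ i, (k i : ℝ) ^ 2) ^ s := by
  have hN' : (2 : ℝ) ≤ N ∧ (N : ℝ) < 4 := by
    rcases hN with rfl | rfl <;> norm_num
  have hm : 0 < m := lt_trans (div_pos (by norm_num) (by linarith)) hm₁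
  have ha : m / 2 * (2 * δ + s) + 1 = m / 2 * (s + (4 - (N : ℝ)) / 4) := by
    rw [hδ]
    field_simp
    ring
  have hpos : 0 < m / 2 * (2 * δ + s) + 1 := by
    rw [ha]
    exact mul_pos (by linarith) (by linarith)
  refine ⟨(m / 2 * (2 * δ + s) + 1)⁻¹ ^ (m / 2)⁻¹, by positivity, ?_⟩
  intro T hT hT₁ β hβ hsum
  set S := ∑' k : Fin N → ℤ, β k * (1 + 4 * π ^ 2 * ∑ i, (k i : ℝ) ^ 2) ^ s with hS_def
  have hS : 0 ≤ S := tsum_nonneg fun k => mul_nonneg (hβ k) (by positivity)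
  have hterm : ∀ t ∈ Set.Ioc 0 T, ∀ k : Fin N → ℤ,
      β k * Real.exp (-8 * π ^ 2 * (∑ i, (k i : ℝ) ^ 2) * t) ≤
        t ^ s * (β k * (1 + 4 * π ^ 2 * ∑ i, (k i : ℝ) ^ 2) ^ s) := by
    intro t ht k
    have h := exp_neg_two_mul_le_rpow_mul_rpow (x := 4 * π ^ 2 * ∑ i, (k i : ℝ) ^ 2)
      (by linarith) hs₂ (by positivity) ht.1 (ht.2.trans hT₁)
    rw [show -8 * π ^ 2 * (∑ i, (k i : ℝ) ^ 2) * t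
      = -(2 * (4 * π ^ 2 * ∑ i, (k i : ℝ) ^ 2) * t) by ring,
      mul_left_comm (t ^ s)]
    exact mul_le_mul_of_nonneg_left h (hβ k)
  have hnonneg : ∀ (t : ℝ) (k : Fin N → ℤ),
      0 ≤ β k * Real.exp (-8 * π ^ 2 * (∑ i, (k i : ℝ) ^ 2) * t) :=
    fun t k => mul_nonneg (hβ k) (Real.exp_pos _).le
  have hbound : ∀ t ∈ Set.Ioc 0 T,
      t ^ (2 * δ) * ∑' k : Fin N → ℤ,
        β k * Real.exp (-8 * π ^ 2 * (∑ i, (k i : ℝ) ^ 2) * t) ≤ t ^ (2 * δ + s) * S := by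
    intro t ht
    rw [Real.rpow_add ht.1, mul_assoc, hS_def, ← tsum_mul_left (a := t ^ s)]
    exact mul_le_mul_of_nonneg_left
      ((Summable.of_nonneg_of_le (hnonneg t) (hterm t ht) (hsum.mul_left _)).tsum_le_tsum
        (hterm t ht) (hsum.mul_left _)) (Real.rpow_nonneg ht.1.le _)
  have hmain := integral_Ioc_rpow_le_of_le_mul_rpow (by positivity : 0 < m / 2) hpos hS hT
    (fun t ht => mul_nonneg (Real.rpow_nonneg ht.1.le _) (tsum_nonneg (hnonneg t))) hbound
  rw [show 2 / m = (m / 2)⁻¹ by rw [inv_div]]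
  refine hmain.trans ?_
  have hexp : 2 * ϱ ≤ 2 * δ + s + (m / 2)⁻¹ := by
    have h₁ : ϱ ≤ s / 2 + (4 - (N : ℝ)) / 8 := hϱ ▸ min_le_right _ _
    have h₂ : (m / 2)⁻¹ = 2 * (1 / m) := by rw [inv_div]; ring
    rw [h₂, hδ]
    linarith
  gcongr ?_ * ?_ * _
  exact Real.rpow_le_rpow_of_exponent_ge hT hT₁ hexp
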